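/- Let k be a field, let (A, σ_A) and (B, σ_B) be finitely generated commutative k-algebras equipped with k-algebra involutions, and let f : A → B be an equivariant k-algebra homomorphism (f ∘ σ_A = σ_B ∘ f). Let I_A ⊆ A and I_B ⊆ B be the ideals generated respectively by L_A = {a − σ_A(a) : a ∈ A} and L_B = {b − σ_B(b) : b ∈ B}. Assume: (1) I_A is an invertible ideal of A and I_B is an invertible ideal of B (each finitely generated projective of rank one over the respective ring), and (2) I_B equals the ideal of B generated by f(L_A). Then the B^{σ_B}-linear map λ_f : B^{σ_B} ⊗_{A^{σ_A}} L_A → L_B, b ⊗ x ↦ b·f(x), is an isomorphism, and the canonical ring homomorphism B^{σ_B} ⊗_{A^{σ_A}} A → B, b ⊗ a ↦ b·f(a), is an isomorphism. -/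

import Mathlib

/-- The fixed subring `A^σ` of a ring involution `σ`. -/
def fixedSubring {A : Type*} [CommRing A] (σ : A →+* A) : Subring A where
  carrier := {a | σ a = a}
  mul_mem' := fun {a b} ha hb => by
    simp only [Set.mem_setOf_eq] at *; rw [map_mul, ha, hb]
  one_mem' := by simp only [Set.mem_setOf_eq, map_one]
  add_mem' := fun {a b} ha hb => by
    simp only [Set.mem_setOf_eq] at *; rw [map_add, ha, hb]
  zero_mem' := by simp only [Set.mem_setOf_eq, map_zero]
  neg_mem' := fun {a} ha => by
    simp only [Set.mem_setOf_eq] at *; rw [map_neg, ha]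

/-- `L_A = {a - σ a : a ∈ A}` as an `A^σ`-submodule of `A`. -/
def lsub {A : Type*} [CommRing A] (σ : A →+* A) : Submodule (fixedSubring σ) A where
  carrier := Set.range fun a => a - σ a
  add_mem' := by
    rintro _ _ ⟨a, rfl⟩ ⟨b, rfl⟩
    exact ⟨a + b, by simp only []; rw [map_add]; ring⟩
  zero_mem' := ⟨0, by simp⟩
  smul_mem' := by
    rintro ⟨c, hc⟩ _ ⟨a, rfl⟩
    refine ⟨c * a, ?_⟩
    have hc' : σ c = c := hc
    show c * a - σ (c * a) = c • (a - σ a)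
    rw [map_mul, hc']
    show c * a - c * σ a = c * (a - σ a)
    ring

section Equivariant

variable {A B : Type*} [CommRing A] [CommRing B]

/-- An equivariant ring homomorphism restricts to a homomorphism of fixed subrings. -/
def fixedHom (σA : A →+* A) (σB : B →+* B) (f : A →+* B)
    (hf : ∀ a : A, f (σA a) = σB (f a)) : fixedSubring σA →+* fixedSubring σB where
  toFun a := ⟨f a, by
    have h : σA (a : A) = a := a.2
    show σB (f a) = f a
    rw [← hf, h]⟩
  map_one' := Subtype.ext (by simp)
  map_mul' x y := Subtype.ext (by simp)
  map_zero' := Subtype.ext (by simp)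
  map_add' x y := Subtype.ext (by simp)

/-- The additive bilinear pairing `(b, a) ↦ b * f a` underlying the map `μ`. -/
def muBil (σB : B →+* B) (f : A →+* B) : fixedSubring σB →+ A →+ B where
  toFun b := (AddMonoidHom.mulLeft (b : B)).comp f.toAddMonoidHom
  map_zero' := by ext a; simp
  map_add' b c := by ext a; simp [add_mul]

/-- The canonical map `μ : B^{σ_B} ⊗_{A^{σ_A}} A → B`, `b ⊗ a ↦ b * f a`, where
`B^{σ_B}` is an `A^{σ_A}`-module via the restriction of `f` to the fixed subrings. -/
noncomputable def muMap (σA : A →+* A) (σB : B →+* B) (f : A →+* B)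
    (hf : ∀ a : A, f (σA a) = σB (f a)) :
    (@TensorProduct (fixedSubring σA) _ (fixedSubring σB) A _ _
      (Module.compHom (fixedSubring σB) (fixedHom σA σB f hf)) _) →+ B :=
  letI : Module (fixedSubring σA) (fixedSubring σB) :=
    Module.compHom (fixedSubring σB) (fixedHom σA σB f hf)
  TensorProduct.liftAddHom (muBil σB f) (by
    rintro r b a
    show ((fixedHom σA σB f hf r * b : fixedSubring σB) : B) * f a = (b : B) * f ((r : A) * a)
    show (f (r : A) * (b : B)) * f a = (b : B) * f ((r : A) * a)
    rw [map_mul]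
    ring)

/-- The additive bilinear pairing `(b, x) ↦ b * f x` underlying the map `λ_f`,
with values in `L_B`. -/
def lamBil (σA : A →+* A) (σB : B →+* B) (f : A →+* B)
    (hf : ∀ a : A, f (σA a) = σB (f a)) : fixedSubring σB →+ lsub σA →+ lsub σB where
  toFun b :=
    { toFun := fun x => ⟨(b : B) * f (x : A), by
        obtain ⟨a, ha⟩ := x.2
        have hb : σB (b : B) = (b : B) := b.2
        refine ⟨(b : B) * f a, ?_⟩
        simp only []
        rw [← ha, map_sub, hf, map_mul, hb]
        ring⟩
      map_zero' := Subtype.ext (by simp)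
      map_add' := fun x y => Subtype.ext (by
        show (b : B) * f ((x : A) + (y : A)) = (b : B) * f (x : A) + (b : B) * f (y : A)
        rw [map_add, mul_add]) }
  map_zero' := by
    ext x
    show ((0 : fixedSubring σB) : B) * f (x : A) = ((0 : lsub σB) : B)
    simp
  map_add' b c := by
    ext x
    show ((b + c : fixedSubring σB) : B) * f (x : A) = _
    simp only [Subring.coe_add, add_mul]
    rfl

/-- The canonical map `λ_f : B^{σ_B} ⊗_{A^{σ_A}} L_A → L_B`, `b ⊗ x ↦ b * f x`. -/
noncomputable def lamMap (σA : A →+* A) (σB : B →+* B) (f : A →+* B)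
    (hf : ∀ a : A, f (σA a) = σB (f a)) :
    (@TensorProduct (fixedSubring σA) _ (fixedSubring σB) (lsub σA) _ _
      (Module.compHom (fixedSubring σB) (fixedHom σA σB f hf)) _) →+ lsub σB :=
  letI : Module (fixedSubring σA) (fixedSubring σB) :=
    Module.compHom (fixedSubring σB) (fixedHom σA σB f hf)
  TensorProduct.liftAddHom (lamBil σA σB f hf) (by
    rintro r b x
    apply Subtype.ext
    show (f (r : A) * (b : B)) * f (x : A) = (b : B) * f ((r : A) * (x : A))
    rw [map_mul]
    ring)

end Equivariant

/-- The ideal `I_A` of `A` generated by `L_A = {a - σ a : a ∈ A}`. -/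
def iideal {A : Type*} [CommRing A] (σ : A →+* A) : Ideal A :=
  Ideal.span (Set.range fun a => a - σ a)

/-- An ideal is invertible if it is a finitely generated projective module of rank one. -/
def IsInvertibleIdeal {A : Type*} [CommRing A] (I : Ideal A) : Prop :=
  Module.Finite A I ∧ Module.Projective A I ∧
    ∀ p : PrimeSpectrum A, Module.rankAtStalk (R := A) I p = 1

section Helpers

/-- The trace ideal of an invertible ideal is everything. -/
theorem trace_eq_top_of_invertible {A : Type*} [CommRing A] {I : Ideal A}
    (h : IsInvertibleIdeal I) :
    Ideal.span {a : A | ∃ (φ : I →ₗ[A] A) (x : I), φ x = a} = ⊤ := by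
  obtain ⟨hfin, hproj, hrank⟩ := h
  set T := Ideal.span {a : A | ∃ (φ : I →ₗ[A] A) (x : I), φ x = a} with hT
  have hle : (⊤ : Submodule A I) ≤ T • (⊤ : Submodule A I) := by
    intro x _
    obtain ⟨s, hs⟩ := (Module.projective_def'.mp hproj)
    have hx : Finsupp.linearCombination A id (s x) = x := by
      have := LinearMap.congr_fun hs x
      simpa using this
    rw [← hx, Finsupp.linearCombination_apply]
    refine Submodule.sum_mem _ fun i _ => ?_
    refine Submodule.smul_mem_smul (Ideal.subset_span ?_) trivial
    exact ⟨(Finsupp.lapply i).comp s, x, rfl⟩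
  obtain ⟨r, hr1, hr0⟩ := Submodule.exists_sub_one_mem_and_smul_eq_zero_of_fg_of_le_smul
    T (⊤ : Submodule A I) Module.Finite.fg_top hle
  by_contra hne
  obtain ⟨m, hm, hTm⟩ := Ideal.exists_le_maximal T hne
  let p : PrimeSpectrum A := ⟨m, hm.isPrime⟩
  have hp : p ∈ Module.support A I := by
    rw [← Module.rankAtStalk_pos_iff_mem_support, hrank]
    exact one_pos
  rw [Module.mem_support_iff_of_finite] at hp
  have hrm : r ∈ m := hp (Module.mem_annihilator.mpr fun x => hr0 x trivial)
  apply hm.ne_top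
  rw [Ideal.eq_top_iff_one]
  have := m.sub_mem hrm (hTm hr1)
  simpa using this

theorem faithful_of_invertible {A : Type*} [CommRing A] {I : Ideal A}
    (h : IsInvertibleIdeal I) (c : A) (hc : ∀ x ∈ I, c * x = 0) : c = 0 := by
  have h1 : (1 : A) ∈ Ideal.span {a : A | ∃ (φ : I →ₗ[A] A) (x : I), φ x = a} := by
    rw [trace_eq_top_of_invertible h]; trivial
  have h2 : Ideal.span {a : A | ∃ (φ : I →ₗ[A] A) (x : I), φ x = a} ≤
      LinearMap.ker (LinearMap.mulLeft A c) := by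
    rw [Ideal.span_le]
    rintro _ ⟨φ, x, rfl⟩
    have : c • x = 0 := Subtype.ext (hc x x.2)
    simp only [SetLike.mem_coe, LinearMap.mem_ker, LinearMap.mulLeft_apply]
    rw [← smul_eq_mul, ← map_smul, this, map_zero]
  simpa using h2 h1

theorem map_mem_iideal {A : Type*} [CommRing A] (σ : A →+* A) (x : A)
    (hx : x ∈ iideal σ) : σ x ∈ iideal σ := by
  have : iideal σ ≤ (iideal σ).comap σ := by
    unfold iideal
    rw [Ideal.span_le]
    rintro _ ⟨a, rfl⟩
    simp only [SetLike.mem_coe, Ideal.mem_comap, map_sub]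
    exact Ideal.subset_span ⟨σ a, rfl⟩
  exact this hx

theorem map_lsub {A : Type*} [CommRing A] (σ : A →+* A) (hσ : ∀ a, σ (σ a) = a) (x : A)
    (hx : x ∈ lsub σ) : σ x = - x := by
  obtain ⟨a, rfl⟩ := hx
  simp only [map_sub, hσ]; ring

theorem span_local_gen_eq_top {A : Type*} [CommRing A] (σ : A →+* A)
    (h : IsInvertibleIdeal (iideal σ)) :
    Ideal.span {a : A | ∃ l ∈ lsub σ, ∀ x ∈ iideal σ, ∃ c, a * x = c * l} = ⊤ := by
  rw [eq_top_iff, ← trace_eq_top_of_invertible h, Ideal.span_le]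
  rintro _ ⟨φ, ⟨x, hx⟩, rfl⟩
  have key : ∀ (y : A) (hy : y ∈ iideal σ), φ ⟨y, hy⟩ ∈
      Ideal.span {a : A | ∃ l ∈ lsub σ, ∀ x ∈ iideal σ, ∃ c, a * x = c * l} := by
    intro y hy
    refine Submodule.span_induction (p := fun y hy => φ ⟨y, hy⟩ ∈
      Ideal.span {a : A | ∃ l ∈ lsub σ, ∀ x ∈ iideal σ, ∃ c, a * x = c * l})
      ?_ ?_ ?_ ?_ hy
    · rintro l hl
      refine Ideal.subset_span ⟨l, hl, fun z hz => ⟨φ ⟨z, hz⟩, ?_⟩⟩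
      rw [mul_comm, ← smul_eq_mul, ← map_smul, mul_comm, ← smul_eq_mul, ← map_smul]
      congr 1
      exact Subtype.ext (mul_comm z l)
    · have h0 : φ ⟨0, Ideal.zero_mem _⟩ = 0 := φ.map_zero
      show φ ⟨0, Ideal.zero_mem _⟩ ∈ _
      rw [h0]
      exact Ideal.zero_mem _
    · intro a b ha hb h1 h2
      have := Ideal.add_mem _ h1 h2
      rwa [← map_add] at this
    · intro a b hb h1
      have := Ideal.mul_mem_left _ a h1
      rwa [← smul_eq_mul, ← map_smul] at this
  exact key x hx

theorem span_fixed_local_gen_eq_top {A : Type*} [CommRing A] (σ : A →+* A)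
    (hσ : ∀ a, σ (σ a) = a) (h : IsInvertibleIdeal (iideal σ)) :
    Ideal.span {a : fixedSubring σ |
      ∃ l ∈ lsub σ, ∀ x ∈ iideal σ, ∃ c, (a : A) * x = c * l} = ⊤ := by
  by_contra hne
  obtain ⟨p, hp, hle⟩ := Ideal.exists_le_maximal _ hne
  have hint : Algebra.IsIntegral (fixedSubring σ) A := by
    refine ⟨fun a => ?_⟩
    let t : fixedSubring σ := ⟨a + σ a, by
      show σ (a + σ a) = a + σ a
      rw [map_add, hσ, add_comm]⟩
    let n : fixedSubring σ := ⟨a * σ a, by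
      show σ (a * σ a) = a * σ a
      rw [map_mul, hσ, mul_comm]⟩
    refine ⟨Polynomial.X ^ 2 - (Polynomial.C t * Polynomial.X - Polynomial.C n), ?_, ?_⟩
    · refine Polynomial.monic_X_pow_sub (n := 2) ?_
      compute_degree
      norm_num
    · simp only [Polynomial.eval₂_sub, Polynomial.eval₂_pow, Polynomial.eval₂_X,
        Polynomial.eval₂_mul, Polynomial.eval₂_C]
      show a ^ 2 - ((a + σ a) * a - a * σ a) = 0
      ring
  obtain ⟨Q, hQ, hQp⟩ := Ideal.exists_ideal_over_maximal_of_isIntegral (S := A) p (by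
    rw [(RingHom.injective_iff_ker_eq_bot _).mp]
    · exact bot_le
    · exact Subtype.val_injective)
  have hmem : ∀ a : fixedSubring σ, (∃ l ∈ lsub σ, ∀ x ∈ iideal σ, ∃ c, (a : A) * x = c * l) →
      (a : A) ∈ Q := by
    intro a ha
    have : a ∈ Q.comap (algebraMap (fixedSubring σ) A) := by
      rw [hQp]; exact hle (Ideal.subset_span ha)
    exact this
  apply hQ.ne_top
  rw [eq_top_iff, ← span_local_gen_eq_top σ h, Ideal.span_le]
  rintro a ⟨l, hl, ha⟩
  have hσa : ∀ x ∈ iideal σ, ∃ c, σ a * x = c * l := by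
    intro x hx
    obtain ⟨c, hc⟩ := ha (σ x) (map_mem_iideal σ x hx)
    refine ⟨- σ c, ?_⟩
    have := congrArg σ hc
    rw [map_mul, map_mul, hσ, map_lsub σ hσ l hl] at this
    rw [this]; ring
  have h1 : a + σ a ∈ Q := hmem ⟨a + σ a, by
      show σ (a + σ a) = a + σ a
      rw [map_add, hσ, add_comm]⟩ ⟨l, hl, fun x hx => by
    obtain ⟨c, hc⟩ := ha x hx
    obtain ⟨d, hd⟩ := hσa x hx
    exact ⟨c + d, by rw [add_mul, add_mul, hc, hd]⟩⟩
  have h2 : a * σ a ∈ Q := hmem ⟨a * σ a, by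
      show σ (a * σ a) = a * σ a
      rw [map_mul, hσ, mul_comm]⟩ ⟨l, hl, fun x hx => by
    obtain ⟨c, hc⟩ := hσa x hx
    exact ⟨a * c, by rw [mul_assoc, hc, mul_assoc]⟩⟩
  rcases hQ.isPrime.mem_or_mem h2 with h3 | h3
  · exact h3
  · simpa using Q.sub_mem h1 h3

/-- If `h I ⊆ A l` then `l` is a non-zero-divisor up to `h`. -/
theorem torsion_aux {A : Type*} [CommRing A] {I : Ideal A} (h : IsInvertibleIdeal I)
    (g l : A) (hg : ∀ x ∈ I, ∃ c, g * x = c * l) (c : A) (hc : c * l = 0) : g * c = 0 := by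
  apply faithful_of_invertible h
  intro x hx
  obtain ⟨d, hd⟩ := hg x hx
  linear_combination c * hd + d * hc

/-- If `h I ⊆ A l` then `h ^ 2 L ⊆ A^σ l`. -/
theorem gen_aux {A : Type*} [CommRing A] (σ : A →+* A)
    (hσ : ∀ a, σ (σ a) = a) (h : IsInvertibleIdeal (iideal σ)) (g l : A) (hgσ : σ g = g)
    (hl : l ∈ lsub σ) (hg : ∀ x ∈ iideal σ, ∃ c, g * x = c * l) (x : A) (hx : x ∈ lsub σ) :
    ∃ c : fixedSubring σ, g ^ 2 * x = c * l := by
  obtain ⟨c, hc⟩ := hg x (Ideal.subset_span hx)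
  have h1 := congrArg σ hc
  rw [map_mul, map_mul, hgσ, map_lsub σ hσ l hl, map_lsub σ hσ x hx] at h1
  have h2 : g * (σ c - c) = 0 :=
    torsion_aux h g l hg _ (by linear_combination hc + h1)
  refine ⟨⟨g * c, ?_⟩, ?_⟩
  · show σ (g * c) = g * c
    rw [map_mul, hgσ]; linear_combination h2
  · show g ^ 2 * x = g * c * l
    linear_combination g * hc

theorem one_mem_of_pow_mem {R : Type*} [CommRing R] (S : Set R) (hS : Ideal.span S = ⊤)
    (K : Ideal R) (n : ℕ) (h : ∀ s ∈ S, s ^ n ∈ K) : (1 : R) ∈ K := by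
  have h1 := Ideal.span_pow_eq_top S hS n
  have h2 : Ideal.span ((fun x => x ^ n) '' S) ≤ K := by
    rw [Ideal.span_le]
    rintro _ ⟨s, hs, rfl⟩
    exact h s hs
  rw [h1] at h2
  exact h2 trivial

variable {A B : Type*} [CommRing A] [CommRing B]

theorem main_aux (σA : A →+* A) (hσA : ∀ a : A, σA (σA a) = a)
    (σB : B →+* B) (hσB : ∀ b : B, σB (σB b) = b)
    (f : A →+* B) (hf : ∀ a : A, f (σA a) = σB (f a))
    (hpureA : IsInvertibleIdeal (iideal σA))
    (hpureB : IsInvertibleIdeal (iideal σB))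
    (hFPR : iideal σB = Ideal.span (⇑f '' (lsub σA : Set A))) :
    Function.Bijective (lamMap σA σB f hf) ∧ Function.Bijective (muMap σA σB f hf) := by
  letI : Module (fixedSubring σA) (fixedSubring σB) :=
    Module.compHom (fixedSubring σB) (fixedHom σA σB f hf)
  have hspan := span_fixed_local_gen_eq_top σA hσA hpureA
  have hlam : ∀ b x, ((lamMap σA σB f hf (b ⊗ₜ x) : lsub σB) : B) = (b : B) * f (x : A) :=
    fun b x => rfl
  have hmu : ∀ b x, muMap σA σB f hf (b ⊗ₜ x) = (b : B) * f x := fun b x => rfl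
  have hmuadd : ∀ s t, muMap σA σB f hf (s + t) = muMap σA σB f hf s + muMap σA σB f hf t :=
    fun s t => AddMonoidHom.map_add _ s t
  have hlamsmul : ∀ (a : fixedSubring σA) t, ((lamMap σA σB f hf (a • t) : lsub σB) : B) =
      f a * (lamMap σA σB f hf t : lsub σB) := by
    intro a t
    induction t using TensorProduct.induction_on with
    | zero => simp
    | tmul b x =>
      rw [TensorProduct.smul_tmul']
      erw [hlam, hlam]
      show f a * (b : B) * f x = _
      ring
    | add s t hs ht =>
      rw [smul_add, map_add, map_add]
      show _ + _ = f a * (_ + _)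
      rw [hs, ht, mul_add]
  -- local generators in `B`
  have hgenB : ∀ (a : fixedSubring σA) (l : A),
      (∀ x ∈ iideal σA, ∃ c, (a : A) * x = c * l) →
      ∀ y ∈ iideal σB, ∃ c, f a * y = c * f l := by
    intro a l hal y hy
    rw [hFPR] at hy
    refine Submodule.span_induction (p := fun y _ => ∃ c, f a * y = c * f l) ?_ ?_ ?_ ?_ hy
    · rintro _ ⟨x, hx, rfl⟩
      obtain ⟨c, hc⟩ := hal x (Ideal.subset_span hx)
      exact ⟨f c, by rw [← map_mul, hc, map_mul]⟩
    · exact ⟨0, by simp⟩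
    · rintro x y _ _ ⟨c, hc⟩ ⟨d, hd⟩
      exact ⟨c + d, by rw [mul_add, hc, hd, add_mul]⟩
    · rintro b x _ ⟨c, hc⟩
      exact ⟨b * c, by rw [smul_eq_mul]; linear_combination b * hc⟩
  have hfl : ∀ l ∈ lsub σA, f l ∈ lsub σB := by
    rintro _ ⟨a, rfl⟩
    exact ⟨f a, by simp [hf]⟩
  have hlaminj : Function.Injective (lamMap σA σB f hf) := by
    rw [injective_iff_map_eq_zero]
    intro t ht
    have h1 : (1 : fixedSubring σA) ∈ LinearMap.ker
        (LinearMap.toSpanSingleton (fixedSubring σA)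
          (TensorProduct (fixedSubring σA) (fixedSubring σB) (lsub σA)) t) := by
      refine one_mem_of_pow_mem _ hspan _ 3 ?_
      rintro a ⟨l, hl, hal⟩
      rw [LinearMap.mem_ker, LinearMap.toSpanSingleton_apply]
      have hex : ∀ t : TensorProduct (fixedSubring σA) (fixedSubring σB) (lsub σA),
          ∃ b : fixedSubring σB, a ^ 2 • t = b ⊗ₜ (⟨l, hl⟩ : lsub σA) := by
        intro t
        induction t using TensorProduct.induction_on with
        | zero => exact ⟨0, by simp⟩
        | tmul b x =>
          obtain ⟨c, hc⟩ := gen_aux σA hσA hpureA a l a.2 hl hal x x.2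
          refine ⟨c • b, ?_⟩
          rw [TensorProduct.smul_tmul, ← TensorProduct.tmul_smul]
          congr 1
          exact Subtype.ext hc
        | add s t hs ht =>
          obtain ⟨b, hb⟩ := hs
          obtain ⟨c, hc⟩ := ht
          exact ⟨b + c, by rw [smul_add, hb, hc, TensorProduct.add_tmul]⟩
      obtain ⟨b, hb⟩ := hex t
      have h2 : (b : B) * f l = 0 := by
        have := hlamsmul (a ^ 2) t
        rw [ht, hb] at this
        erw [hlam] at this
        simpa using this
      have h3 := torsion_aux hpureB (f a) (f l) (hgenB a l hal) b h2
      have h4 : a • b = 0 := Subtype.ext h3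
      rw [pow_succ', mul_smul, hb, TensorProduct.smul_tmul', h4, TensorProduct.zero_tmul]
    simpa using h1
  have hlamsurj : Function.Surjective (lamMap σA σB f hf) := by
    intro y
    let K : Ideal (fixedSubring σA) :=
      { carrier := {a | ∃ t, ((lamMap σA σB f hf t : lsub σB) : B) = f a * y}
        add_mem' := by
          rintro a b ⟨s, hs⟩ ⟨t, ht⟩
          refine ⟨s + t, ?_⟩
          rw [map_add]
          show _ + _ = f ((a : A) + b) * _
          rw [hs, ht, map_add, add_mul]
        zero_mem' := ⟨0, by simp⟩
        smul_mem' := by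
          rintro a b ⟨t, ht⟩
          refine ⟨a • t, ?_⟩
          rw [hlamsmul, ht]
          show _ = f ((a : A) * b) * _
          rw [map_mul, mul_assoc] }
    have h1 : (1 : fixedSubring σA) ∈ K := by
      refine one_mem_of_pow_mem _ hspan _ 2 ?_
      rintro a ⟨l, hl, hal⟩
      obtain ⟨c, hc⟩ := gen_aux σB hσB hpureB (f a) (f l)
        (by rw [← hf]; exact congrArg f a.2) (hfl l hl) (hgenB a l hal) y y.2
      refine ⟨c ⊗ₜ (⟨l, hl⟩ : lsub σA), ?_⟩
      erw [hlam]
      show _ = f ((a : A) ^ 2) * _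
      rw [map_pow, hc]
    obtain ⟨t, ht⟩ := h1
    exact ⟨t, Subtype.ext (by simpa using ht)⟩
  refine ⟨⟨hlaminj, hlamsurj⟩, ?_⟩
  -- the exact sequence `A^σ → A → L_A → 0`
  let i : fixedSubring σA →ₗ[fixedSubring σA] A := Algebra.linearMap _ _
  let d : A →ₗ[fixedSubring σA] lsub σA :=
    { toFun := fun a => ⟨a - σA a, a, rfl⟩
      map_add' := fun a b => Subtype.ext (by
        show a + b - σA (a + b) = (a - σA a) + (b - σA b)
        rw [map_add]; ring)
      map_smul' := fun r a => Subtype.ext (by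
        have hr : σA (r : A) = r := r.2
        show (r : A) * a - σA (r * a) = r * (a - σA a)
        rw [map_mul, hr]; ring) }
  have hd : Function.Surjective d := by
    rintro ⟨_, a, rfl⟩
    exact ⟨a, rfl⟩
  have hex : Function.Exact i d := by
    intro a
    constructor
    · intro h
      have h' : a - σA a = 0 := congrArg Subtype.val h
      exact ⟨⟨a, (sub_eq_zero.mp h').symm⟩, rfl⟩
    · rintro ⟨⟨a, ha⟩, rfl⟩
      have ha' : σA a = a := ha
      refine Subtype.ext ?_
      show a - σA a = 0
      rw [ha', sub_self]
  have hexT := lTensor_exact (fixedSubring σB) hex hd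
  have hsurjT := LinearMap.lTensor_surjective (fixedSubring σB) hd
  have hcompat : ∀ t, ((lamMap σA σB f hf (d.lTensor (fixedSubring σB) t) : lsub σB) : B) =
      muMap σA σB f hf t - σB (muMap σA σB f hf t) := by
    intro t
    induction t using TensorProduct.induction_on with
    | zero => simp
    | tmul b x =>
      have hb : σB (b : B) = b := b.2
      rw [LinearMap.lTensor_tmul]
      erw [hlam, hmu]
      show (b : B) * f (x - σA x) = _
      rw [map_sub, hf, map_mul, hb]
      ring
    | add s t hs ht =>
      rw [map_add, map_add, hmuadd, map_add]
      show _ + _ = _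
      rw [hs, ht]
      ring
  have hrange : ∀ u, ∃ b : fixedSubring σB,
      i.lTensor (fixedSubring σB) u = b ⊗ₜ (1 : A) := by
    intro u
    induction u using TensorProduct.induction_on with
    | zero => exact ⟨0, by simp⟩
    | tmul b x =>
      refine ⟨x • b, ?_⟩
      rw [LinearMap.lTensor_tmul, TensorProduct.smul_tmul]
      congr 1
      exact (mul_one (x : A)).symm
    | add s t hs ht =>
      obtain ⟨b, hb⟩ := hs
      obtain ⟨c, hc⟩ := ht
      exact ⟨b + c, by rw [map_add, hb, hc, TensorProduct.add_tmul]⟩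
  constructor
  · rw [injective_iff_map_eq_zero]
    intro t ht
    have h1 : d.lTensor (fixedSubring σB) t = 0 := by
      apply hlaminj
      apply Subtype.ext
      rw [hcompat, ht]
      simp
    obtain ⟨u, rfl⟩ := (hexT t).mp h1
    obtain ⟨b, hb⟩ := hrange u
    rw [hb] at ht ⊢
    erw [hmu] at ht
    rw [map_one, mul_one] at ht
    have hb0 : b = 0 := Subtype.ext ht
    rw [hb0, TensorProduct.zero_tmul]
  · intro b
    obtain ⟨s, hs⟩ := hlamsurj ⟨b - σB b, b, rfl⟩
    obtain ⟨t, rfl⟩ := hsurjT s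
    have h1 := hcompat t
    rw [hs] at h1
    have h1' : b - σB b = muMap σA σB f hf t - σB (muMap σA σB f hf t) := h1
    let c : fixedSubring σB := ⟨b - muMap σA σB f hf t, by
      show σB (b - muMap σA σB f hf t) = b - muMap σA σB f hf t
      rw [map_sub]; linear_combination -h1'⟩
    refine ⟨t + c ⊗ₜ (1 : A), ?_⟩
    rw [hmuadd]
    erw [hmu]
    show _ + (b - muMap σA σB f hf t) * f 1 = b
    rw [map_one]; ring

end Helpers

/-- If `f : (A, σ_A) → (B, σ_B)` is an equivariant homomorphism of finitely generated
algebras with involution over a field `k`, both `(A, σ_A)` and `(B, σ_B)` are pure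
(`I_A` and `I_B` are invertible ideals) and `f` is fixed-point reflecting (`I_B` is
generated by `f(L_A)`), then `λ_f : B^{σ_B} ⊗_{A^{σ_A}} L_A → L_B` is an isomorphism and
the canonical map `μ : B^{σ_B} ⊗_{A^{σ_A}} A → B` is an isomorphism. -/
theorem lamMap_and_muMap_bijective_of_pure_of_FPR
    {k : Type*} [Field k] {A B : Type*} [CommRing A] [CommRing B]
    [Algebra k A] [Algebra k B] [Algebra.FiniteType k A] [Algebra.FiniteType k B]
    (σA : A →ₐ[k] A) (hσA : ∀ a : A, σA (σA a) = a)
    (σB : B →ₐ[k] B) (hσB : ∀ b : B, σB (σB b) = b)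
    (f : A →ₐ[k] B) (hf : ∀ a : A, f.toRingHom (σA.toRingHom a) = σB.toRingHom (f.toRingHom a))
    (hpureA : IsInvertibleIdeal (iideal σA.toRingHom))
    (hpureB : IsInvertibleIdeal (iideal σB.toRingHom))
    (hFPR : iideal σB.toRingHom =
      Ideal.span (⇑f.toRingHom '' (lsub σA.toRingHom : Set A))) :
    Function.Bijective (lamMap σA.toRingHom σB.toRingHom f.toRingHom hf) ∧
      Function.Bijective (muMap σA.toRingHom σB.toRingHom f.toRingHom hf) := by
  exact main_aux σA.toRingHom hσA σB.toRingHom hσB f.toRingHom hf hpureA hpureB hFPR
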